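/- If W is a walk ending at a vertex v with ℓ(W) < 0, then W contains a negative edge, and the suffix of W starting at the tail of its first negative edge is a walk from a negative vertex to v of length at most ℓ(W). Consequently, d(V,v) = min(0, d(N,v)) for every vertex v. -/

import Mathlib

open scoped Classical

variable {V : Type*}

/-- `l` is a (nonempty) walk in the edge set `E`: a list of at least one vertex,
with every consecutive pair of vertices being an edge of `E`.
A single-vertex list is the empty walk at that vertex. -/
def IsWalk (E : Set (V × V)) (l : List V) : Prop :=
  l ≠ [] ∧ l.Chain' (fun a b => (a, b) ∈ E)

/-- `l` is a walk in `E` from `s` to `t`. -/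
def IsWalkFrom (E : Set (V × V)) (l : List V) (s t : V) : Prop :=
  IsWalk E l ∧ l.head? = some s ∧ l.getLast? = some t

/-- The edges of a walk, in order, with multiplicity. -/
def walkEdges (l : List V) : List (V × V) := l.zip l.tail

/-- The length of a walk with respect to edge lengths `ℓ`. -/
noncomputable def walkLen (ℓ : V × V → ℝ) (l : List V) : ℝ :=
  ((walkEdges l).map ℓ).sum

/-- The tails of the negative edges along a walk, in order, with multiplicity. -/
noncomputable def negTails (ℓ : V × V → ℝ) (l : List V) : List V :=
  ((walkEdges l).filter (fun p => ℓ p < 0)).map Prod.fst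

/-- The number of hops (negative edges, counted with multiplicity) of a walk. -/
noncomputable def hops (ℓ : V × V → ℝ) (l : List V) : ℕ :=
  (negTails ℓ l).length

/-- The set of negative vertices: tails of negative edges. -/
def negVerts (E : Set (V × V)) (ℓ : V × V → ℝ) : Set V :=
  {u | ∃ v, (u, v) ∈ E ∧ ℓ (u, v) < 0}

/-- `r`-hop distance: infimum (in the extended reals) of lengths of walks
from `s` to `t` with at most `r` hops. -/
noncomputable def hopDist (E : Set (V × V)) (ℓ : V × V → ℝ) (r : ℕ) (s t : V) : EReal :=
  sInf {x : EReal | ∃ l, IsWalkFrom E l s t ∧ hops ℓ l ≤ r ∧ x = (walkLen ℓ l : ℝ)}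

/-- Distance: infimum (in the extended reals) of lengths of all walks from `s` to `t`. -/
noncomputable def dist' (E : Set (V × V)) (ℓ : V × V → ℝ) (s t : V) : EReal :=
  sInf {x : EReal | ∃ l, IsWalkFrom E l s t ∧ x = (walkLen ℓ l : ℝ)}

/-- Proper `h`-hop distance: infimum of lengths of walks from `s` to `t` with
exactly `h` negative edges whose tails are pairwise distinct. -/
noncomputable def properHopDist (E : Set (V × V)) (ℓ : V × V → ℝ) (h : ℕ) (s t : V) : EReal :=
  sInf {x : EReal | ∃ l, IsWalkFrom E l s t ∧ hops ℓ l = h ∧ (negTails ℓ l).Nodup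
    ∧ x = (walkLen ℓ l : ℝ)}

/-- `r`-hop distance from a set of sources. -/
noncomputable def hopDistFromSet (E : Set (V × V)) (ℓ : V × V → ℝ) (r : ℕ) (S : Set V)
    (t : V) : EReal :=
  ⨅ s ∈ S, hopDist E ℓ r s t

/-- `r`-hop distance to a set of sinks. -/
noncomputable def hopDistToSet (E : Set (V × V)) (ℓ : V × V → ℝ) (r : ℕ) (s : V)
    (T : Set V) : EReal :=
  ⨅ t ∈ T, hopDist E ℓ r s t

/-- `φ` is a valid potential for edge lengths `ℓ`: reweighting introduces no new
negative edges. -/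
def ValidPotential (E : Set (V × V)) (ℓ : V × V → ℝ) (φ : V → ℝ) : Prop :=
  ∀ e ∈ E, 0 ≤ ℓ e → 0 ≤ ℓ e + φ e.1 - φ e.2

/-- The reweighted edge lengths `ℓ_φ`. -/
def reweight (ℓ : V × V → ℝ) (φ : V → ℝ) : V × V → ℝ :=
  fun e => ℓ e + φ e.1 - φ e.2

/-- A walk of negative length has a first negative edge, and dropping the edges before it does not
increase the length. -/
theorem exists_first_neg_edge {V : Type*} (ℓ : V × V → ℝ) (l : List V) (h : walkLen ℓ l < 0) :
    ∃ i, ∃ (h₀ : i < l.length) (h₁ : i + 1 < l.length),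
      ℓ (l[i], l[i + 1]) < 0 ∧
      (∀ k, (hk₀ : k < l.length) → (hk₁ : k + 1 < l.length) → k < i →
        ¬ ℓ (l[k], l[k + 1]) < 0) ∧
      walkLen ℓ (l.drop i) ≤ walkLen ℓ l := by
  induction l with
  | nil => simp [walkLen, walkEdges] at h
  | cons a l ih =>
    cases l with
    | nil => simp [walkLen, walkEdges] at h
    | cons b t =>
      have hlen : walkLen ℓ (a :: b :: t) = ℓ (a, b) + walkLen ℓ (b :: t) := by
        simp [walkLen, walkEdges]
      by_cases hab : ℓ (a, b) < 0
      · exact ⟨0, by simp, by simp, hab, by simp, le_rfl⟩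
      · obtain ⟨i, hi₀, hi, hneg, hfirst, hle⟩ := ih (by linarith)
        refine ⟨i + 1, by simpa using hi₀, by simpa using hi, hneg, ?_, ?_⟩
        · rintro (_ | k) hk₀ hk hki
          · exact hab
          · exact hfirst k (by simpa using hk₀) (by simpa using hk) (by omega)
        · rw [List.drop_succ_cons]
          linarith

theorem IsWalkFrom.drop {V : Type*} {E : Set (V × V)} {l : List V} {u v : V}
    (h : IsWalkFrom E l u v) {i : ℕ} (hi : i < l.length) :
    IsWalkFrom E (l.drop i) l[i] v := by
  obtain ⟨⟨-, hchain⟩, -, hlast⟩ := h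
  refine ⟨⟨by simpa using hi, List.IsChain.drop hchain i⟩, ?_, ?_⟩
  · simp [List.head?_drop, hi]
  · rw [List.getLast?_drop, if_neg (by omega), hlast]

theorem dist'_le_walkLen {V : Type*} {E : Set (V × V)} {l : List V} {u v : V}
    (ℓ : V × V → ℝ) (h : IsWalkFrom E l u v) : dist' E ℓ u v ≤ (walkLen ℓ l : ℝ) :=
  sInf_le ⟨l, h, rfl⟩

theorem dist'_self_le_zero {V : Type*} (E : Set (V × V)) (ℓ : V × V → ℝ) (v : V) :
    dist' E ℓ v v ≤ 0 := by
  have h : IsWalkFrom E [v] v v := ⟨⟨by simp, List.isChain_singleton v⟩, rfl, rfl⟩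
  simpa [walkLen, walkEdges] using dist'_le_walkLen ℓ h

/-- Every negative-length walk `W` ending at `v` contains a negative
edge, and the suffix of `W` starting at the tail of its first negative edge is a walk
from a negative vertex to `v` of length at most `ℓ(W)`. Consequently,
`d(V,v) = min (0, d(N,v))` for every vertex `v`. -/
theorem statement7 {V : Type*} [Fintype V] (E : Set (V × V)) (ℓ : V × V → ℝ) :
    (∀ (u v : V) (l : List V), IsWalkFrom E l u v → walkLen ℓ l < 0 →
      ∃ i, ∃ (hi : i + 1 < l.length),
        ℓ (l[i], l[i + 1]) < 0 ∧
        (∀ k, (hk : k + 1 < l.length) → k < i → ¬ ℓ (l[k], l[k + 1]) < 0) ∧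
        l[i] ∈ negVerts E ℓ ∧
        IsWalkFrom E (l.drop i) l[i] v ∧
        walkLen ℓ (l.drop i) ≤ walkLen ℓ l) ∧
    (∀ v : V, (⨅ u : V, dist' E ℓ u v)
      = min 0 (⨅ u ∈ negVerts E ℓ, dist' E ℓ u v)) := by
  have key : ∀ (u v : V) (l : List V), IsWalkFrom E l u v → walkLen ℓ l < 0 →
      ∃ i, ∃ (hi : i + 1 < l.length),
        ℓ (l[i], l[i + 1]) < 0 ∧
        (∀ k, (hk : k + 1 < l.length) → k < i → ¬ ℓ (l[k], l[k + 1]) < 0) ∧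
        l[i] ∈ negVerts E ℓ ∧
        IsWalkFrom E (l.drop i) l[i] v ∧
        walkLen ℓ (l.drop i) ≤ walkLen ℓ l := by
    intro u v l hl hneg
    obtain ⟨i, hi₀, hi, hedge, hfirst, hle⟩ := exists_first_neg_edge ℓ l hneg
    exact ⟨i, hi, hedge, fun k hk => hfirst k (by omega) hk, ⟨l[i + 1], List.isChain_iff_getElem.mp hl.1.2 i hi, hedge⟩,
      hl.drop hi₀, hle⟩
  refine ⟨key, fun v => le_antisymm ?_ ?_⟩
  · exact le_min ((iInf_le _ v).trans (dist'_self_le_zero E ℓ v))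
      (le_iInf₂ fun u _ => iInf_le _ u)
  · refine le_iInf fun u => le_sInf ?_
    rintro _ ⟨l, hl, rfl⟩
    by_cases hneg : walkLen ℓ l < 0
    · obtain ⟨i, hi, -, -, hmem, hwalk, hle⟩ := key u v l hl hneg
      exact (min_le_right _ _).trans <| (iInf₂_le l[i] hmem).trans <|
        (dist'_le_walkLen ℓ hwalk).trans <| EReal.coe_le_coe_iff.mpr hle
    · exact (min_le_left _ _).trans <| EReal.coe_nonneg.mpr (not_lt.mp hneg)
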